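/- arXiv:2112.12495 — 3 statements merged into one kernel-verified Lean document; each statement's English description precedes it below -/
import Mathlib

section
/- Let m ≥ 1, let s_0, …, s_{l−1} be positive integers with s_0 + ⋯ + s_{l−1} = m, and for each i < l set ν_i = Σ_{j>i} s_j, so that the blocks of variable indices B_i = {ν_i, …, ν_i + s_i − 1} partition {0, …, m−1}. Let C be a monomial code on m variables that is invariant under every permutation of the variables that maps each block B_i to itself. For each i < l, let φ(C, i) be the set of all codes obtained from C by ν_i successive decomposition steps, where each step replaces a code D on the variables {x_t, …, x_{m−1}} by either D⁽⁻⁾ or D⁽⁺⁾ with respect to the variable x_t. Then every code in φ(C, i) is invariant under every permutation of the variables {x_{ν_i}, …, x_{ν_i + s_i − 1}}. -/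
/-- Boolean functions in `m` variables. -/
abbrev BF (m : ℕ) := (Fin m → ZMod 2) → ZMod 2

/-- The monomial `x^v`. -/
def monomialBF {m : ℕ} (v : Fin m → ZMod 2) : BF m :=
  fun x => ∏ i, x i ^ (v i).val

/-- The monomial code generated by the exponent set `V`. -/
def monomialCode {m : ℕ} (V : Set (Fin m → ZMod 2)) : Submodule (ZMod 2) (BF m) :=
  Submodule.span (ZMod 2) (monomialBF '' V)

/-- The action of a variable permutation on Boolean functions:
`(π · f)(x₀, …, x_{m-1}) = f(x_{π 0}, …, x_{π (m-1)})`. -/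
def permAction {m : ℕ} (π : Equiv.Perm (Fin m)) : BF m →ₗ[ZMod 2] BF m where
  toFun f := fun x => f (x ∘ π)
  map_add' _ _ := rfl
  map_smul' _ _ := rfl

/-- The derivative in direction `b`: `(D_b f)(x) = f(x + b) + f(x)`. -/
def derivBF {m : ℕ} (b : Fin m → ZMod 2) : BF m →ₗ[ZMod 2] BF m where
  toFun f := fun x => f (x + b) + f x
  map_add' f g := by funext x; show (f + g) (x + b) + (f + g) x = _; simp [Pi.add_apply]; ring
  map_smul' c f := by funext x; show (c • f) (x + b) + (c • f) x = _; simp [Pi.smul_apply]; ring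

/-- Restriction of a Boolean function in `m = n+1` variables to the points with `x_i = 0`,
viewed as a Boolean function of the remaining `n` variables. -/
def restrictZero {n : ℕ} (i : Fin (n + 1)) : BF (n + 1) →ₗ[ZMod 2] BF n where
  toFun f := fun y => f (i.insertNth 0 y)
  map_add' _ _ := rfl
  map_smul' _ _ := rfl

/-- The partial-derivative code `C⁽⁻⁾` with respect to the variable `x_i`. -/
def codeMinus {n : ℕ} (i : Fin (n + 1)) (C : Submodule (ZMod 2) (BF (n + 1))) :
    Submodule (ZMod 2) (BF n) :=
  Submodule.map (restrictZero i ∘ₗ derivBF (Pi.single i 1)) C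

/-- The code `C⁽⁺⁾` with respect to the variable `x_i`. -/
def codePlus {n : ℕ} (i : Fin (n + 1)) (C : Submodule (ZMod 2) (BF (n + 1))) :
    Submodule (ZMod 2) (BF n) :=
  Submodule.map (restrictZero i) (C ⊓ LinearMap.ker (derivBF (Pi.single i 1)))

/-- `DescendsTo C k D` holds iff the code `D` is obtained from the code `C` by `k` successive
decomposition steps, where each step replaces a code `E` (on the variables `x_t, …, x_{m-1}`,
reindexed so that `x_t` is the variable of index `0`) by either `E⁽⁻⁾` or `E⁽⁺⁾` with respect
to its first variable `x_t`. -/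
inductive DescendsTo : {a : ℕ} → Submodule (ZMod 2) (BF a) → (k : ℕ) →
    {b : ℕ} → Submodule (ZMod 2) (BF b) → Prop
  | refl {a : ℕ} (C : Submodule (ZMod 2) (BF a)) : DescendsTo C 0 C
  | minus {a b k : ℕ} (C : Submodule (ZMod 2) (BF (a + 1))) (D : Submodule (ZMod 2) (BF b)) :
      DescendsTo (codeMinus 0 C) k D → DescendsTo C (k + 1) D
  | plus {a b k : ℕ} (C : Submodule (ZMod 2) (BF (a + 1))) (D : Submodule (ZMod 2) (BF b)) :
      DescendsTo (codePlus 0 C) k D → DescendsTo C (k + 1) D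

/-- The extension of a permutation of `n` variables to `n + 1` variables fixing the first one. -/
def extendPerm {n : ℕ} (σ : Equiv.Perm (Fin n)) : Equiv.Perm (Fin (n + 1)) :=
  Equiv.Perm.decomposeFin.symm (0, σ)

@[simp]
theorem extendPerm_zero {n : ℕ} (σ : Equiv.Perm (Fin n)) : extendPerm σ 0 = 0 := by
  simp [extendPerm]

@[simp]
theorem extendPerm_succ {n : ℕ} (σ : Equiv.Perm (Fin n)) (j : Fin n) :
    extendPerm σ j.succ = (σ j).succ := by
  simp [extendPerm]

theorem insertNth_zero_comp_extendPerm {n : ℕ} (σ : Equiv.Perm (Fin n)) (y : Fin n → ZMod 2) :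
    (Fin.insertNth (α := fun _ => ZMod 2) 0 0 y) ∘ extendPerm σ =
      Fin.insertNth (α := fun _ => ZMod 2) 0 0 (y ∘ σ) := by
  funext j
  refine Fin.cases ?_ (fun j => ?_) j <;> simp

theorem add_single_zero_comp_extendPerm {n : ℕ} (σ : Equiv.Perm (Fin n))
    (x : Fin (n + 1) → ZMod 2) :
    (x + Pi.single 0 1) ∘ extendPerm σ = x ∘ extendPerm σ + Pi.single 0 1 := by
  funext j
  refine Fin.cases ?_ (fun j => ?_) j <;> simp

theorem restrictZero_permAction_extendPerm {n : ℕ} (σ : Equiv.Perm (Fin n)) (f : BF (n + 1)) :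
    restrictZero 0 (permAction (extendPerm σ) f) = permAction σ (restrictZero 0 f) := by
  funext y
  exact congrArg f (insertNth_zero_comp_extendPerm σ y)

theorem derivBF_permAction_extendPerm {n : ℕ} (σ : Equiv.Perm (Fin n)) (f : BF (n + 1)) :
    derivBF (Pi.single 0 1) (permAction (extendPerm σ) f) =
      permAction (extendPerm σ) (derivBF (Pi.single 0 1) f) := by
  funext x
  exact congrArg (f · + f (x ∘ extendPerm σ)) (add_single_zero_comp_extendPerm σ x)

theorem map_permAction_codeMinus_le {n : ℕ} (σ : Equiv.Perm (Fin n))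
    {C : Submodule (ZMod 2) (BF (n + 1))}
    (h : Submodule.map (permAction (extendPerm σ)) C ≤ C) :
    Submodule.map (permAction σ) (codeMinus 0 C) ≤ codeMinus 0 C := by
  rintro _ ⟨_, ⟨f, hf, rfl⟩, rfl⟩
  refine ⟨permAction (extendPerm σ) f, h ⟨f, hf, rfl⟩, ?_⟩
  rw [LinearMap.comp_apply, derivBF_permAction_extendPerm, restrictZero_permAction_extendPerm,
    LinearMap.comp_apply]

theorem map_permAction_codePlus_le {n : ℕ} (σ : Equiv.Perm (Fin n))
    {C : Submodule (ZMod 2) (BF (n + 1))}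
    (h : Submodule.map (permAction (extendPerm σ)) C ≤ C) :
    Submodule.map (permAction σ) (codePlus 0 C) ≤ codePlus 0 C := by
  rintro _ ⟨_, ⟨f, ⟨hf, hker⟩, rfl⟩, rfl⟩
  refine ⟨permAction (extendPerm σ) f, ⟨h ⟨f, hf, rfl⟩, ?_⟩,
    restrictZero_permAction_extendPerm σ f⟩
  have hzero : derivBF (Pi.single 0 1) f = 0 := hker
  change derivBF (Pi.single 0 1) (permAction (extendPerm σ) f) = 0
  rw [derivBF_permAction_extendPerm, hzero, map_zero]

theorem permAction_injective {m : ℕ} (π : Equiv.Perm (Fin m)) :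
    Function.Injective (permAction π) := by
  intro f g h
  funext x
  simpa [permAction, Function.comp_assoc] using congrFun h (x ∘ π.symm)

theorem map_permAction_eq_of_le {m : ℕ} {π : Equiv.Perm (Fin m)}
    {C : Submodule (ZMod 2) (BF m)} (h : Submodule.map (permAction π) C ≤ C) :
    Submodule.map (permAction π) C = C :=
  Submodule.eq_of_le_of_finrank_eq h
    (Submodule.equivMapOfInjective _ (permAction_injective π) C).finrank_eq.symm

/-- `π` acts trivially on the indices `< k` and as the `k`-shift of `σ` on the others. -/
structure IsShiftOf {a b : ℕ} (k : ℕ) (σ : Equiv.Perm (Fin b)) (π : Equiv.Perm (Fin a)) :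
    Prop where
  apply_lt : ∀ j : Fin a, (j : ℕ) < k → π j = j
  apply_add : ∀ (i : Fin a) (j : Fin b), (i : ℕ) = j + k → (π i : ℕ) = σ j + k

theorem IsShiftOf.extendPerm {a b k : ℕ} {σ : Equiv.Perm (Fin b)} {π : Equiv.Perm (Fin a)}
    (h : IsShiftOf k σ π) : IsShiftOf (k + 1) σ (extendPerm π) where
  apply_lt j := by
    refine Fin.cases ?_ (fun j => ?_) j
    · simp
    · intro hj
      rw [extendPerm_succ, h.apply_lt j (by simpa using hj)]
  apply_add i j := by
    refine Fin.cases ?_ (fun i => ?_) i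
    · intro hi
      simp at hi
    · intro hi
      have := h.apply_add i j (by simp at hi; omega)
      rw [extendPerm_succ, Fin.val_succ]
      omega

theorem DescendsTo.exists_isShiftOf {a b k : ℕ} {C : Submodule (ZMod 2) (BF a)}
    {D : Submodule (ZMod 2) (BF b)} (h : DescendsTo C k D) (σ : Equiv.Perm (Fin b)) :
    a = b + k ∧ ∃ π : Equiv.Perm (Fin a), IsShiftOf k σ π ∧
      (Submodule.map (permAction π) C ≤ C → Submodule.map (permAction σ) D ≤ D) := by
  induction h with
  | refl C =>
    refine ⟨rfl, σ, ⟨fun _ hj => absurd hj (Nat.not_lt_zero _), fun i j hij => ?_⟩, id⟩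
    rw [Fin.ext (by simpa using hij) (a := i) (b := j), Nat.add_zero]
  | minus C D _ ih =>
    obtain ⟨hab, π, hπ, hle⟩ := ih σ
    exact ⟨by omega, extendPerm π, hπ.extendPerm,
      fun hC => hle (map_permAction_codeMinus_le π hC)⟩
  | plus C D _ ih =>
    obtain ⟨hab, π, hπ, hle⟩ := ih σ
    exact ⟨by omega, extendPerm π, hπ.extendPerm,
      fun hC => hle (map_permAction_codePlus_le π hC)⟩

theorem sum_Ico_succ_add_le_of_lt {s : ℕ → ℕ} {i j l : ℕ} (hij : i < j) (hj : j < l) :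
    ∑ t ∈ Finset.Ico (j + 1) l, s t + s j ≤ ∑ t ∈ Finset.Ico (i + 1) l, s t := by
  rw [add_comm, ← Finset.sum_eq_sum_Ico_succ_bot hj]
  exact Finset.sum_le_sum_of_subset (Finset.Ico_subset_Ico_left hij)

/-- Let `m ≥ 1`, let `s 0, …, s (l-1)` be positive integers summing to `m`, and
for `i < l` set `ν i = ∑_{i < j < l} s j`, so that the blocks `B i = {ν i, …, ν i + s i - 1}`
partition `{0, …, m-1}`.  Suppose the monomial code `C(V)` on `m` variables is invariant under
every permutation of the variables mapping each block `B i` to itself.  Then, for every `i < l`,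
every code `D` obtained from `C(V)` by `ν i` successive decomposition steps (i.e. every element
of `φ(C, i)`, a code on the variables `x_{ν i}, …, x_{m-1}`, with local index `j`
corresponding to the variable `x_{ν i + j}`) is invariant under every permutation of the
variables `{x_{ν i}, …, x_{ν i + s i - 1}}` (i.e. every permutation fixing all local indices
`≥ s i`). -/
theorem polar_SC_recursion_symmetry (m l : ℕ) (hm : 1 ≤ m) (s : ℕ → ℕ)
    (hspos : ∀ i < l, 0 < s i) (hssum : ∑ i ∈ Finset.range l, s i = m)
    (ν : ℕ → ℕ) (hν : ∀ i, ν i = ∑ j ∈ Finset.Ico (i + 1) l, s j)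
    (V : Set (Fin m → ZMod 2))
    (hinv : ∀ π : Equiv.Perm (Fin m),
      (∀ i < l, ∀ k : Fin m, ν i ≤ (k : ℕ) → (k : ℕ) < ν i + s i →
        ν i ≤ ((π k : Fin m) : ℕ) ∧ ((π k : Fin m) : ℕ) < ν i + s i) →
      Submodule.map (permAction π) (monomialCode V) = monomialCode V) :
    ∀ i < l, ∀ (b : ℕ) (D : Submodule (ZMod 2) (BF b)),
      DescendsTo (monomialCode V) (ν i) D →
      ∀ σ : Equiv.Perm (Fin b), (∀ j : Fin b, s i ≤ (j : ℕ) → σ j = j) →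
        Submodule.map (permAction σ) D = D := by
  intro i hi b D hD σ hσ
  obtain ⟨hm', π, hπ, hle⟩ := hD.exists_isShiftOf σ
  refine map_permAction_eq_of_le (hle (hinv π fun i' hi' k hk hk' => ?_).le)
  rcases lt_or_ge (k : ℕ) (ν i) with hlt | hge
  · rw [hπ.apply_lt k hlt]
    exact ⟨hk, hk'⟩
  obtain ⟨j, hj⟩ : ∃ j : Fin b, (k : ℕ) = j + ν i :=
    ⟨⟨k - ν i, by omega⟩, (Nat.sub_add_cancel hge).symm⟩
  have hπk := hπ.apply_add k j hj
  rcases lt_or_ge (j : ℕ) (s i) with hjs | hjs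
  · have hσj : (σ j : ℕ) < s i := by
      by_contra! hcon
      have := σ.injective (hσ (σ j) hcon)
      rw [this] at hcon
      omega
    have hii : i' = i := by
      rcases lt_trichotomy i' i with hlt | heq | hgt
      · have := sum_Ico_succ_add_le_of_lt (s := s) hlt hi
        rw [← hν, ← hν] at this
        omega
      · exact heq
      · have := sum_Ico_succ_add_le_of_lt (s := s) hgt hi'
        rw [← hν, ← hν] at this
        omega
    subst hii
    omega
  · rw [hσ j hjs] at hπk
    omega
end

section
/- Let V ⊆ 𝔽₂^m with m ≥ 1 and let i ∈ {0, …, m−1}. The code C(V)⁽⁺⁾ with respect to the variable x_i equals the monomial code on the m−1 variables {x_j : j ≠ i} whose exponent set is {v restricted to the coordinates ≠ i : v ∈ V, v_i = 0}. -/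
theorem monomialBF_insertNth {n : ℕ} (i : Fin (n + 1)) (v : Fin (n + 1) → ZMod 2) (a : ZMod 2)
    (y : Fin n → ZMod 2) :
    monomialBF v (i.insertNth a y) = a ^ (v i).val * monomialBF (v ∘ i.succAbove) y := by
  simp [monomialBF, Fin.prod_univ_succAbove _ i]

theorem restrictZero_monomialBF_of_eq_zero {n : ℕ} {i : Fin (n + 1)} {v : Fin (n + 1) → ZMod 2}
    (hv : v i = 0) : restrictZero i (monomialBF v) = monomialBF (v ∘ i.succAbove) := by
  funext y
  exact (monomialBF_insertNth i v 0 y).trans (by simp [hv])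

theorem restrictZero_monomialBF_of_ne_zero {n : ℕ} {i : Fin (n + 1)} {v : Fin (n + 1) → ZMod 2}
    (hv : v i ≠ 0) : restrictZero i (monomialBF v) = 0 := by
  funext y
  exact (monomialBF_insertNth i v 0 y).trans (by simp [hv])

theorem derivBF_single_monomialBF_of_eq_zero {m : ℕ} {i : Fin m} {v : Fin m → ZMod 2}
    (hv : v i = 0) : derivBF (Pi.single i 1) (monomialBF v) = 0 := by
  funext x
  have h : monomialBF v (x + Pi.single i 1) = monomialBF v x := by
    refine Finset.prod_congr rfl fun j _ => ?_
    obtain rfl | hj := eq_or_ne j i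
    · simp [hv]
    · simp [hj]
  change monomialBF v (x + Pi.single i 1) + monomialBF v x = 0
  rw [h, CharTwo.add_self_eq_zero]

/-- For `V ⊆ 𝔽₂^m` with `m = n + 1 ≥ 1` and `i < m`, the code `C(V)⁽⁺⁾` with
respect to the variable `x_i` equals the monomial code on the `m - 1` remaining variables
(reindexed via `Fin.succAbove i`) whose exponent set is
`{v restricted to the coordinates ≠ i : v ∈ V, v_i = 0}`. -/
theorem codePlus_monomialCode (n : ℕ) (i : Fin (n + 1)) (V : Set (Fin (n + 1) → ZMod 2)) :
    codePlus i (monomialCode V) =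
      monomialCode ((fun v : Fin (n + 1) → ZMod 2 => v ∘ i.succAbove) ''
        {v | v ∈ V ∧ v i = 0}) := by
  apply le_antisymm
  · refine (Submodule.map_mono inf_le_left).trans ?_
    rw [monomialCode, Submodule.map_span_le]
    rintro _ ⟨v, hv, rfl⟩
    by_cases h : v i = 0
    · rw [restrictZero_monomialBF_of_eq_zero h]
      exact Submodule.subset_span ⟨_, ⟨v, ⟨hv, h⟩, rfl⟩, rfl⟩
    · rw [restrictZero_monomialBF_of_ne_zero h]
      exact Submodule.zero_mem _
  · refine Submodule.span_le.2 ?_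
    rintro _ ⟨_, ⟨v, ⟨hv, h⟩, rfl⟩, rfl⟩
    exact ⟨monomialBF v, ⟨Submodule.subset_span ⟨v, hv, rfl⟩,
      derivBF_single_monomialBF_of_eq_zero h⟩, restrictZero_monomialBF_of_eq_zero h⟩
end

section
/- Let m ≥ 1 and let V ⊆ 𝔽₂^m be closed under all permutations of the m coordinates (so membership of v in V depends only on the Hamming weight of v). Then |{v ∈ V : v_0 = 0}| − |{v ∈ V : v_0 = 1}| ≤ binom(m−1, ⌊(m−1)/2⌋). Equivalently, for the fully symmetric monomial code C(V), dim C(V)⁽⁺⁾ − dim C(V)⁽⁻⁾ ≤ binom(m−1, ⌊(m−1)/2⌋), where C(V)⁽⁻⁾ and C(V)⁽⁺⁾ are taken with respect to the variable x_0. -/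
theorem hammingNorm_cons {n : ℕ} (c : ZMod 2) (w : Fin n → ZMod 2) :
    hammingNorm (Fin.cons c w : Fin (n + 1) → ZMod 2) = hammingNorm w + c.val := by
  simp only [hammingNorm, Fin.card_filter_univ_succ, Fin.cons_zero, Fin.cons_succ]
  have key : ∀ (a : ZMod 2) (k : ℕ), (if a ≠ 0 then k + 1 else k) = k + a.val := by
    intro a k
    fin_cases a <;> rfl
  exact key c _

/-- Vectors over `ZMod 2` of equal Hamming weight differ by a coordinate permutation. -/
theorem exists_perm_comp_eq_of_hammingNorm_eq {m : ℕ} {u v : Fin m → ZMod 2}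
    (h : hammingNorm u = hammingNorm v) : ∃ π : Equiv.Perm (Fin m), u ∘ π = v := by
  have e : {i // v i ≠ 0} ≃ {i // u i ≠ 0} :=
    Fintype.equivOfCardEq (by simpa only [Fintype.card_subtype, hammingNorm] using h.symm)
  refine ⟨e.extendSubtype, funext fun i => ?_⟩
  have key : ∀ a b : ZMod 2, (a ≠ 0 ↔ b ≠ 0) → a = b := by decide
  refine key _ _ ?_
  by_cases hi : v i ≠ 0
  · exact iff_of_true (e.extendSubtype_mem i hi) hi
  · exact iff_of_false (e.extendSubtype_not_mem i hi) hi

theorem mem_iff_exists_hammingNorm_eq {m : ℕ} {V : Set (Fin m → ZMod 2)}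
    (hsym : ∀ π : Equiv.Perm (Fin m), ∀ v ∈ V, v ∘ ⇑π ∈ V) (v : Fin m → ZMod 2) :
    v ∈ V ↔ hammingNorm v ∈ hammingNorm '' V := by
  refine ⟨fun h => ⟨v, h, rfl⟩, ?_⟩
  rintro ⟨u, hu, h⟩
  obtain ⟨π, rfl⟩ := exists_perm_comp_eq_of_hammingNorm_eq h
  exact hsym π u hu

/-- The support, as an equivalence between vectors over `ZMod 2` and finite sets. -/
def supportEquiv (n : ℕ) : (Fin n → ZMod 2) ≃ Finset (Fin n) where
  toFun v := {i | v i ≠ 0}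
  invFun s i := if i ∈ s then 1 else 0
  left_inv v := by
    have key : ∀ a : ZMod 2, (if a ≠ 0 then (1 : ZMod 2) else 0) = a := by decide
    funext i
    simpa using key (v i)
  right_inv s := by ext i; simp

/-- Vectors of `V` with first coordinate `c` correspond to their tails. -/
def sliceEquiv {n : ℕ} (V : Set (Fin (n + 1) → ZMod 2)) (c : ZMod 2) :
    {v | v ∈ V ∧ v 0 = c} ≃ {w : Fin n → ZMod 2 | (Fin.cons c w : Fin (n + 1) → ZMod 2) ∈ V} where
  toFun v := ⟨Fin.tail v.1, by
    obtain ⟨v, hv, rfl⟩ := v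
    simpa using hv⟩
  invFun w := ⟨Fin.cons c w.1, w.2, Fin.cons_zero _ _⟩
  left_inv := by
    rintro ⟨v, hv, rfl⟩
    simp
  right_inv w := by simp

open Classical in
theorem card_slice {n : ℕ} {V : Set (Fin (n + 1) → ZMod 2)}
    (hsym : ∀ π : Equiv.Perm (Fin (n + 1)), ∀ v ∈ V, v ∘ ⇑π ∈ V) (c : ZMod 2) :
    Nat.card {v | v ∈ V ∧ v 0 = c} =
      ∑ k ∈ Finset.range (n + 1),
        n.choose k * if k + c.val ∈ hammingNorm '' V then 1 else 0 := by
  have e : {w : Fin n → ZMod 2 | (Fin.cons c w : Fin (n + 1) → ZMod 2) ∈ V} ≃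
      {s : Finset (Fin n) // s.card + c.val ∈ hammingNorm '' V} :=
    (supportEquiv n).subtypeEquiv fun w => by
      rw [Set.mem_ofPred_eq, mem_iff_exists_hammingNorm_eq hsym, hammingNorm_cons]
      rfl
  rw [Nat.card_congr ((sliceEquiv V c).trans e), Nat.card_eq_fintype_card, Fintype.card_subtype,
    Finset.card_filter]
  simpa only [Finset.powerset_univ, Finset.card_univ, Fintype.card_fin, smul_eq_mul] using
    Finset.sum_powerset_apply_card (α := ℕ) (x := (Finset.univ : Finset (Fin n)))
      (fun k => if k + c.val ∈ hammingNorm '' V then 1 else 0)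

theorem choose_succ_le_of_half_le {n k : ℕ} (h : n / 2 ≤ k) :
    n.choose (k + 1) ≤ n.choose k := by
  refine Nat.le_of_mul_le_mul_right (c := k + 1) ?_ k.succ_pos
  rw [Nat.choose_succ_right_eq]
  exact Nat.mul_le_mul_left _ (by omega)

open Classical in
/-- For a unimodal sequence, the difference between a partial sum over `W` and the partial sum
over `W` shifted by one is at most the peak value. -/
theorem sum_indicator_le_sum_indicator_succ_add {f : ℕ → ℕ} {p N : ℕ}
    (hmono : ∀ k < p, f k ≤ f (k + 1)) (hanti : ∀ k, p ≤ k → f (k + 1) ≤ f k) (hN : p ≤ N)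
    (W : Set ℕ) :
    ∑ k ∈ Finset.range (N + 1), f k * (if k ∈ W then 1 else 0) ≤
      ∑ k ∈ Finset.range N, f k * (if k + 1 ∈ W then 1 else 0) + f p := by
  have rise : ∀ j ≤ p, ∑ k ∈ Finset.range (j + 1), f k * (if k ∈ W then 1 else 0) ≤
      ∑ k ∈ Finset.range j, f k * (if k + 1 ∈ W then 1 else 0) + f j := by
    intro j hj
    induction j with
    | zero => simp; split_ifs <;> simp
    | succ j ih =>
      specialize ih (by omega)
      have := hmono j hj
      simp only [Finset.sum_range_succ, mul_ite, mul_one, mul_zero] at ih ⊢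
      split_ifs at ih ⊢ <;> omega
  induction N, hN using Nat.le_induction with
  | base => exact rise p le_rfl
  | succ j hj ih =>
    have := hanti j hj
    simp only [Finset.sum_range_succ, mul_ite, mul_one, mul_zero] at ih ⊢
    split_ifs at ih ⊢ <;> omega

theorem card_slice_zero_le {n : ℕ} {V : Set (Fin (n + 1) → ZMod 2)}
    (hsym : ∀ π : Equiv.Perm (Fin (n + 1)), ∀ v ∈ V, v ∘ ⇑π ∈ V) :
    Nat.card {v | v ∈ V ∧ v 0 = 0} ≤ Nat.card {v | v ∈ V ∧ v 0 = 1} + n.choose (n / 2) := by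
  classical
  rw [card_slice hsym, card_slice hsym]
  refine (sum_indicator_le_sum_indicator_succ_add (f := n.choose) (p := n / 2)
    (fun k hk => Nat.choose_le_succ_of_lt_half_left hk)
    (fun k hk => choose_succ_le_of_half_le hk) (Nat.div_le_self n 2) _).trans ?_
  rw [Finset.sum_range_succ _ n]
  exact Nat.add_le_add_right (Nat.le_add_right _ _) _

theorem card_slice_add_card_slice {n : ℕ} (V : Set (Fin (n + 1) → ZMod 2)) :
    Nat.card {v | v ∈ V ∧ v 0 = 0} + Nat.card {v | v ∈ V ∧ v 0 = 1} = Nat.card V := by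
  have key : ∀ a : ZMod 2, a = 1 ↔ ¬ a = 0 := by decide
  have := Set.ncard_inter_add_ncard_sdiff_eq_ncard V {v | v 0 = 0}
  simp only [Nat.card_coe_set_eq, key]
  exact this

theorem monomialBF_self {m : ℕ} (v : Fin m → ZMod 2) : monomialBF v v = 1 := by
  have key : ∀ a : ZMod 2, a ^ a.val = 1 := by decide
  simp [monomialBF, key]

theorem monomialBF_eq_zero_of_hammingNorm_le {m : ℕ} {u v : Fin m → ZMod 2}
    (h : hammingNorm v ≤ hammingNorm u) (hne : u ≠ v) : monomialBF u v = 0 := by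
  by_contra hu
  have key : ∀ a b : ZMod 2, b ^ a.val ≠ 0 → a ≠ 0 → b ≠ 0 := by decide
  have hsub : (supportEquiv m u) ⊆ supportEquiv m v := by
    intro i
    simpa [supportEquiv] using
      key (u i) (v i) (Finset.prod_ne_zero_iff.mp hu i (Finset.mem_univ i))
  exact hne ((supportEquiv m).injective (Finset.eq_of_subset_of_card_le hsub h))

theorem linearIndependent_monomialBF (m : ℕ) :
    LinearIndependent (ZMod 2) (monomialBF : (Fin m → ZMod 2) → BF m) := by
  rw [Fintype.linearIndependent_iff]
  intro g hg v
  induction hk : hammingNorm v using Nat.strong_induction_on generalizing v with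
  | _ k ih =>
    have hv := congrFun hg v
    rw [Finset.sum_apply, Finset.sum_eq_single v] at hv
    · simpa [monomialBF_self] using hv
    · intro u _ hu
      by_cases h : hammingNorm u < k
      · simp [ih _ h u rfl]
      · simp [monomialBF_eq_zero_of_hammingNorm_le (hk.trans_le (not_lt.mp h)) hu]
    · simp

theorem restrictZero_derivBF_monomialBF_cons_one {n : ℕ} (w : Fin n → ZMod 2) :
    restrictZero 0 (derivBF (Pi.single 0 1) (monomialBF (Fin.cons 1 w))) = monomialBF w := by
  funext y
  simp [restrictZero, derivBF, monomialBF, Fin.prod_univ_succ, ZMod.val_one]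

theorem card_slice_one_le_finrank_codeMinus {n : ℕ} (V : Set (Fin (n + 1) → ZMod 2)) :
    Nat.card {v | v ∈ V ∧ v 0 = 1} ≤
      Module.finrank (ZMod 2) (codeMinus 0 (monomialCode V)) := by
  classical
  rw [Nat.card_congr (sliceEquiv V 1), Nat.card_eq_fintype_card,
    ← finrank_span_eq_card ((linearIndependent_monomialBF n).comp _ Subtype.val_injective)]
  refine Submodule.finrank_mono (Submodule.span_le.mpr ?_)
  rintro _ ⟨⟨w, hw⟩, rfl⟩
  exact ⟨monomialBF (Fin.cons 1 w), Submodule.subset_span ⟨_, hw, rfl⟩,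
    restrictZero_derivBF_monomialBF_cons_one w⟩

theorem finrank_codePlus_add_finrank_codeMinus_le {n : ℕ} (i : Fin (n + 1))
    (C : Submodule (ZMod 2) (BF (n + 1))) :
    Module.finrank (ZMod 2) (codePlus i C) + Module.finrank (ZMod 2) (codeMinus i C) ≤
      Module.finrank (ZMod 2) C := by
  set D := restrictZero i ∘ₗ derivBF (Pi.single i 1)
  rw [← (D.domRestrict C).finrank_range_add_finrank_ker, LinearMap.range_domRestrict, add_comm]
  refine Nat.add_le_add_left ((Submodule.finrank_map_le _ _).trans ?_) _
  rw [← Submodule.finrank_map_subtype_eq C]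
  refine Submodule.finrank_mono ?_
  rintro f ⟨hf, hd⟩
  exact ⟨⟨f, hf⟩, (congrArg (restrictZero i) hd).trans (map_zero _), rfl⟩

theorem finrank_monomialCode_le {m : ℕ} (V : Set (Fin m → ZMod 2)) :
    Module.finrank (ZMod 2) (monomialCode V) ≤ Nat.card V := by
  classical
  rw [monomialCode, Set.image_eq_range, Nat.card_eq_fintype_card]
  exact finrank_range_le_card _

/-- Let `m = n + 1 ≥ 1` and let `V ⊆ 𝔽₂^m` be closed under all permutations
of the `m` coordinates.  Then
`|{v ∈ V : v 0 = 0}| - |{v ∈ V : v 0 = 1}| ≤ binom(m - 1, ⌊(m - 1) / 2⌋)`;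
equivalently, for the fully symmetric monomial code `C(V)`,
`dim C(V)⁽⁺⁾ - dim C(V)⁽⁻⁾ ≤ binom(m - 1, ⌊(m - 1) / 2⌋)`, where `C(V)⁽⁻⁾` and `C(V)⁽⁺⁾` are
taken with respect to the variable `x_0`. -/
theorem symmetric_code_dim_gap (n : ℕ) (V : Set (Fin (n + 1) → ZMod 2))
    (hsym : ∀ π : Equiv.Perm (Fin (n + 1)), ∀ v ∈ V, v ∘ ⇑π ∈ V) :
    Nat.card {v | v ∈ V ∧ v 0 = 0} - Nat.card {v | v ∈ V ∧ v 0 = 1} ≤ n.choose (n / 2) ∧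
    Module.finrank (ZMod 2) (codePlus 0 (monomialCode V)) -
        Module.finrank (ZMod 2) (codeMinus 0 (monomialCode V)) ≤ n.choose (n / 2) := by
  have hcard := card_slice_zero_le hsym
  have hV := card_slice_add_card_slice V
  have hminus := card_slice_one_le_finrank_codeMinus V
  have hplus := finrank_codePlus_add_finrank_codeMinus_le 0 (monomialCode V)
  have hdim := finrank_monomialCode_le V
  omega
end
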